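/- arXiv:2410.17220 — 4 statements merged into one kernel-verified Lean document; each statement's English description precedes it below -/
import Mathlib

section
/- For every p ∈ ℝ^n and every x ∈ ℝ^n with x ≥ 0, the minimum over u ∈ U(x) of s^T x + r^T u + p^T(Ax + Bu) exists, is attained, and equals (T(p))^T x, where T(p) = s + A^T p + Σ_{i=1}^n min{r_i + B_i^T p, 0} E_i. Moreover the minimum is attained at u = Kx for some K ∈ 𝒦. -/
open Matrix Finset

/-- `minZero v` is the minimum of the entries of `v` and of the scalar `0`. -/
noncomputable def minZero {k : ℕ} (v : Fin k → ℝ) : ℝ :=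
  (insert (0 : ℝ) (Finset.image v Finset.univ)).min' (Finset.insert_nonempty _ _)

/-- The Bellman operator `T(p) = s + Aᵀ p + Σ_i min{r_i + B_iᵀ p, 0} E_i`. -/
noncomputable def bellman {n : ℕ} {m : Fin n → ℕ}
    (A : Matrix (Fin n) (Fin n) ℝ) (B : ∀ i, Matrix (Fin n) (Fin (m i)) ℝ)
    (s : Fin n → ℝ) (r : ∀ i, Fin (m i) → ℝ) (E : Matrix (Fin n) (Fin n) ℝ)
    (p : Fin n → ℝ) : Fin n → ℝ :=
  fun j => s j + (Aᵀ *ᵥ p) j +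
    ∑ i, minZero (fun l => r i l + ((B i)ᵀ *ᵥ p) l) * E i j

/-- Membership in the set 𝒦 of blockwise nonnegative feedback matrices with
full (`1ᵀ K_i = E_iᵀ`) or zero (`1ᵀ K_i = 0`) actuation in each block. -/
def memK {n : ℕ} {m : Fin n → ℕ} (E : Matrix (Fin n) (Fin n) ℝ)
    (K : ∀ i, Matrix (Fin (m i)) (Fin n) ℝ) : Prop :=
  ∀ i, (∀ l j, 0 ≤ K i l j) ∧
    ((∀ j, ∑ l, K i l j = E i j) ∨ (∀ j, ∑ l, K i l j = 0))

/-- Assumption 1: `(A + BK) x ≥ 0` for every `K ∈ 𝒦` and every `x ≥ 0`. -/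
def assumption1 {n : ℕ} {m : Fin n → ℕ}
    (A : Matrix (Fin n) (Fin n) ℝ) (B : ∀ i, Matrix (Fin n) (Fin (m i)) ℝ)
    (E : Matrix (Fin n) (Fin n) ℝ) : Prop :=
  ∀ K : ∀ i, Matrix (Fin (m i)) (Fin n) ℝ, memK E K →
    ∀ x : Fin n → ℝ, 0 ≤ x → 0 ≤ (A + ∑ i, B i * K i) *ᵥ x

/-- The constraint set `U(x) = {u : u ≥ 0, 1ᵀ u_i ≤ E_iᵀ x for all i}`. -/
def inputSet {n : ℕ} {m : Fin n → ℕ} (E : Matrix (Fin n) (Fin n) ℝ)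
    (x : Fin n → ℝ) : Set (∀ i, Fin (m i) → ℝ) :=
  {u | ∀ i, (∀ l, 0 ≤ u i l) ∧ (∑ l, u i l) ≤ ∑ j, E i j * x j}

/-- An admissible trajectory from `x0`: `x(0) = x0`, `u(t) ∈ U(x(t))` and
`x(t+1) = A x(t) + B u(t)`. -/
def admissible {n : ℕ} {m : Fin n → ℕ}
    (A : Matrix (Fin n) (Fin n) ℝ) (B : ∀ i, Matrix (Fin n) (Fin (m i)) ℝ)
    (E : Matrix (Fin n) (Fin n) ℝ) (x0 : Fin n → ℝ)
    (x : ℕ → Fin n → ℝ) (u : ℕ → ∀ i, Fin (m i) → ℝ) : Prop :=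
  x 0 = x0 ∧ ∀ t, u t ∈ inputSet E (x t) ∧
    x (t + 1) = A *ᵥ x t + ∑ i, (B i) *ᵥ (u t i)

/-- The state trajectory generated by a control sequence `u` from `x0`. -/
noncomputable def traj {n : ℕ} {m : Fin n → ℕ}
    (A : Matrix (Fin n) (Fin n) ℝ) (B : ∀ i, Matrix (Fin n) (Fin (m i)) ℝ)
    (x0 : Fin n → ℝ) (u : ℕ → ∀ i, Fin (m i) → ℝ) : ℕ → Fin n → ℝ
  | 0 => x0
  | t + 1 => A *ᵥ traj A B x0 u t + ∑ i, (B i) *ᵥ (u t i)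

/-- Total cost `Σ_{t=0}^∞ [sᵀ x(t) + rᵀ u(t)] ∈ [0,∞]` of a trajectory. -/
noncomputable def trajCost {n : ℕ} {m : Fin n → ℕ}
    (s : Fin n → ℝ) (r : ∀ i, Fin (m i) → ℝ)
    (x : ℕ → Fin n → ℝ) (u : ℕ → ∀ i, Fin (m i) → ℝ) : ENNReal :=
  ∑' t, ENNReal.ofReal ((∑ j, s j * x t j) + ∑ i, ∑ l, r i l * u t i l)

/-- Optimal value `V(x0)`: infimum of the total cost over admissible trajectories. -/
noncomputable def optValue {n : ℕ} {m : Fin n → ℕ}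
    (A : Matrix (Fin n) (Fin n) ℝ) (B : ∀ i, Matrix (Fin n) (Fin (m i)) ℝ)
    (E : Matrix (Fin n) (Fin n) ℝ) (s : Fin n → ℝ) (r : ∀ i, Fin (m i) → ℝ)
    (x0 : Fin n → ℝ) : ENNReal :=
  ⨅ (x : ℕ → Fin n → ℝ) (u : ℕ → ∀ i, Fin (m i) → ℝ)
    (_ : admissible A B E x0 x u), trajCost s r x u

/-- The spectral radius of `M` is strictly less than `1`. -/
def schurStable {n : ℕ} (M : Matrix (Fin n) (Fin n) ℝ) : Prop :=
  ∀ μ ∈ spectrum ℂ (M.map Complex.ofReal), ‖μ‖ < 1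

lemma minZero_nonpos {k : ℕ} (v : Fin k → ℝ) : minZero v ≤ 0 :=
  Finset.min'_le _ _ (by simp)

lemma minZero_le {k : ℕ} (v : Fin k → ℝ) (l : Fin k) : minZero v ≤ v l :=
  Finset.min'_le _ _ (by simp)

lemma minZero_eq_zero_or_exists {k : ℕ} (v : Fin k → ℝ) :
    minZero v = 0 ∨ ∃ l, v l = minZero v := by
  have h := Finset.min'_mem (insert (0 : ℝ) (Finset.image v Finset.univ))
    (Finset.insert_nonempty _ _)
  simpa [minZero] using h

/-- A linear functional on `{u ≥ 0 : 1ᵀ u ≤ e}` is bounded below by `minZero c * e`. -/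
lemma minZero_mul_le_sum {k : ℕ} (c u : Fin k → ℝ) {e : ℝ} (hu : ∀ l, 0 ≤ u l)
    (he : ∑ l, u l ≤ e) : minZero c * e ≤ ∑ l, c l * u l :=
  calc minZero c * e ≤ minZero c * ∑ l, u l :=
        mul_le_mul_of_nonpos_left he (minZero_nonpos c)
    _ = ∑ l, minZero c * u l := Finset.mul_sum ..
    _ ≤ ∑ l, c l * u l := Finset.sum_le_sum fun l _ =>
        mul_le_mul_of_nonneg_right (minZero_le c l) (hu l)

/-- The lower bound of `minZero_mul_le_sum` is attained by a linear feedback that either puts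
all the actuation on one entry or does not actuate at all. -/
lemma exists_feedback_block {n k : ℕ} (c : Fin k → ℝ) (e : Fin n → ℝ) (he : ∀ j, 0 ≤ e j) :
    ∃ K : Matrix (Fin k) (Fin n) ℝ, (∀ l j, 0 ≤ K l j) ∧
      ((∀ j, ∑ l, K l j = e j) ∨ (∀ j, ∑ l, K l j = 0)) ∧
      ∀ x : Fin n → ℝ, ∑ l, c l * (K *ᵥ x) l = minZero c * ∑ j, e j * x j := by
  rcases minZero_eq_zero_or_exists c with h | ⟨l₀, h⟩
  · exact ⟨0, by simp, Or.inr (by simp), by simp [h]⟩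
  · refine ⟨fun l j => if l = l₀ then e j else 0, fun l j => ?_, Or.inl fun j => by simp,
      fun x => ?_⟩
    · dsimp only
      split_ifs
      exacts [he j, le_rfl]
    · rw [Finset.sum_eq_single l₀ (fun l _ hl => by simp [mulVec, dotProduct, hl]) (by simp), h]
      simp [mulVec, dotProduct]

lemma feedback_mem_inputSet {n : ℕ} {m : Fin n → ℕ} {E : Matrix (Fin n) (Fin n) ℝ}
    (hE : ∀ i j, 0 ≤ E i j) {K : ∀ i, Matrix (Fin (m i)) (Fin n) ℝ} (hK : memK E K)
    {x : Fin n → ℝ} (hx : 0 ≤ x) : (fun i => K i *ᵥ x) ∈ inputSet E x := by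
  intro i
  refine ⟨fun l => ?_, ?_⟩
  · change 0 ≤ ∑ j, K i l j * x j
    exact Finset.sum_nonneg fun j _ => mul_nonneg ((hK i).1 l j) (hx j)
  have hsum : ∑ l, (K i *ᵥ x) l = ∑ j, (∑ l, K i l j) * x j := by
    simp only [mulVec, dotProduct, Finset.sum_mul]
    exact Finset.sum_comm
  dsimp only
  rw [hsum]
  refine Finset.sum_le_sum fun j _ => mul_le_mul_of_nonneg_right ?_ (hx j)
  rcases (hK i).2 with h | h
  · exact (h j).le
  · exact (h j).trans_le (hE i j)

/-- The one-step cost separates over the input blocks. -/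
lemma stage_cost_eq {n : ℕ} {m : Fin n → ℕ}
    (A : Matrix (Fin n) (Fin n) ℝ) (B : ∀ i, Matrix (Fin n) (Fin (m i)) ℝ)
    (s : Fin n → ℝ) (r : ∀ i, Fin (m i) → ℝ) (p x : Fin n → ℝ) (u : ∀ i, Fin (m i) → ℝ) :
    (∑ j, s j * x j) + (∑ i, ∑ l, r i l * u i l) +
        ∑ j, p j * (A *ᵥ x + ∑ i, (B i) *ᵥ (u i)) j =
      (∑ j, (s j + (Aᵀ *ᵥ p) j) * x j) +
        ∑ i, ∑ l, (r i l + ((B i)ᵀ *ᵥ p) l) * u i l := by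
  have h : ∑ j, p j * (A *ᵥ x + ∑ i, (B i) *ᵥ (u i)) j =
      (∑ j, (Aᵀ *ᵥ p) j * x j) + ∑ i, ∑ l, ((B i)ᵀ *ᵥ p) l * u i l := by
    change p ⬝ᵥ (A *ᵥ x + ∑ i, (B i) *ᵥ (u i)) =
      (Aᵀ *ᵥ p) ⬝ᵥ x + ∑ i, ((B i)ᵀ *ᵥ p) ⬝ᵥ u i
    simp only [dotProduct_add, dotProduct_sum, dotProduct_mulVec, mulVec_transpose]
  rw [h]
  simp only [add_mul, Finset.sum_add_distrib]
  ring

lemma sum_bellman_mul {n : ℕ} {m : Fin n → ℕ}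
    (A : Matrix (Fin n) (Fin n) ℝ) (B : ∀ i, Matrix (Fin n) (Fin (m i)) ℝ)
    (s : Fin n → ℝ) (r : ∀ i, Fin (m i) → ℝ) (E : Matrix (Fin n) (Fin n) ℝ)
    (p x : Fin n → ℝ) :
    ∑ j, bellman A B s r E p j * x j =
      (∑ j, (s j + (Aᵀ *ᵥ p) j) * x j) +
        ∑ i, minZero (fun l => r i l + ((B i)ᵀ *ᵥ p) l) * ∑ j, E i j * x j := by
  simp only [bellman, add_mul _ (∑ _, _), Finset.sum_add_distrib, Finset.sum_mul, Finset.mul_sum,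
    mul_assoc]
  rw [Finset.sum_comm (γ := Fin n)]

/-- for every `p` and every `x ≥ 0`, the minimum over `u ∈ U(x)` of
`sᵀ x + rᵀ u + pᵀ(Ax + Bu)` exists, is attained, equals `(T p)ᵀ x`, and is
attained at `u = K x` for some `K ∈ 𝒦`. -/
theorem stmt_1 {n : ℕ} {m : Fin n → ℕ}
    (A : Matrix (Fin n) (Fin n) ℝ) (B : ∀ i, Matrix (Fin n) (Fin (m i)) ℝ)
    (s : Fin n → ℝ) (r : ∀ i, Fin (m i) → ℝ) (E : Matrix (Fin n) (Fin n) ℝ)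
    (hr : ∀ i l, 0 ≤ r i l) (hE : ∀ i j, 0 ≤ E i j)
    (p x : Fin n → ℝ) (hx : 0 ≤ x) :
    IsLeast {v : ℝ | ∃ u ∈ inputSet E x, v =
        (∑ j, s j * x j) + (∑ i, ∑ l, r i l * u i l) +
          ∑ j, p j * (A *ᵥ x + ∑ i, (B i) *ᵥ (u i)) j}
      (∑ j, bellman A B s r E p j * x j) ∧
    ∃ K : ∀ i, Matrix (Fin (m i)) (Fin n) ℝ, memK E K ∧
      (fun i => K i *ᵥ x) ∈ inputSet E x ∧
      (∑ j, s j * x j) + (∑ i, ∑ l, r i l * (K i *ᵥ x) l) +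
          (∑ j, p j * (A *ᵥ x + ∑ i, (B i) *ᵥ (K i *ᵥ x)) j) =
        ∑ j, bellman A B s r E p j * x j := by
  choose K hK₀ hK₁ hK using fun i =>
    exists_feedback_block (fun l => r i l + ((B i)ᵀ *ᵥ p) l) (E i) (hE i)
  have hmem : memK E K := fun i => ⟨hK₀ i, hK₁ i⟩
  have hU := feedback_mem_inputSet hE hmem hx
  have heq : (∑ j, s j * x j) + (∑ i, ∑ l, r i l * (K i *ᵥ x) l) +
      (∑ j, p j * (A *ᵥ x + ∑ i, (B i) *ᵥ (K i *ᵥ x)) j) =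
        ∑ j, bellman A B s r E p j * x j := by
    rw [stage_cost_eq A B s r p x fun i => K i *ᵥ x, sum_bellman_mul]
    simp only [hK]
  refine ⟨⟨⟨fun i => K i *ᵥ x, hU, heq.symm⟩, ?_⟩, K, hmem, hU, heq⟩
  rintro _ ⟨u, hu, rfl⟩
  rw [stage_cost_eq, sum_bellman_mul]
  gcongr with i
  exact minZero_mul_le_sum _ _ (hu i).1 (hu i).2
end

section
/- Under Assumption 1, let p ∈ ℝ^n with p ≥ 0 satisfy p = T(p). Define K = [K_1; …; K_n] blockwise as follows: for each i, if the minimum of the entries of r_i + B_i^T p is negative, let j be an index attaining that minimum and set K_i to the m_i × n matrix whose j-th row is E_i^T and whose other rows are zero; otherwise set K_i = 0. Then K ∈ 𝒦, and for every x_0 ≥ 0 the sequences defined by x(0) = x_0, u(t) = K x(t), x(t+1) = (A + BK) x(t) form an admissible trajectory whose cost Σ_{t=0}^∞ [s^T x(t) + r^T u(t)] equals p^T x_0; that is, the linear state feedback u = Kx is optimal. -/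
open Matrix Finset

/-- A nonnegative sequence of stage costs which telescopes along a nonnegative function `V` tending
to zero has total cost `V 0`. -/
lemma tsum_ofReal_eq_of_telescoping {c V : ℕ → ℝ} (hc : ∀ t, 0 ≤ c t)
    (hcV : ∀ t, V t = c t + V (t + 1)) (hV : Filter.Tendsto V Filter.atTop (nhds 0)) :
    ∑' t, ENNReal.ofReal (c t) = ENNReal.ofReal (V 0) := by
  have hsum : ∀ T, ∑ t ∈ Finset.range T, c t = V 0 - V T := by
    intro T
    induction T with
    | zero => simp
    | succ T ih => rw [Finset.sum_range_succ, ih]; linarith [hcV T]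
  have hs : HasSum c (V 0) := by
    rw [hasSum_iff_tendsto_nat_of_nonneg hc]
    simp only [hsum]
    simpa using hV.const_sub (V 0)
  rw [← ENNReal.ofReal_tsum_of_nonneg hc hs.summable, hs.tsum_eq]

/-- If the stage costs of a nonnegative trajectory dominate a positive linear functional of the state
and telescope along a nonnegative linear functional, the trajectory tends to zero along every linear
functional. -/
lemma tendsto_dotProduct_zero_of_telescoping {n : ℕ} {s p : Fin n → ℝ} {x : ℕ → Fin n → ℝ}
    {c : ℕ → ℝ} (hs : ∀ j, 0 < s j) (hp : 0 ≤ p) (hx : ∀ t, 0 ≤ x t)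
    (hsc : ∀ t, s ⬝ᵥ x t ≤ c t) (hcp : ∀ t, p ⬝ᵥ x t = c t + p ⬝ᵥ x (t + 1)) (q : Fin n → ℝ) :
    Filter.Tendsto (fun t => q ⬝ᵥ x t) Filter.atTop (nhds 0) := by
  have hs0 : ∀ t, 0 ≤ s ⬝ᵥ x t := fun t => dotProduct_nonneg_of_nonneg (fun j => (hs j).le) (hx t)
  have hbound : ∀ T, ∑ t ∈ Finset.range T, s ⬝ᵥ x t ≤ p ⬝ᵥ x 0 - p ⬝ᵥ x T := by
    intro T
    induction T with
    | zero => simp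
    | succ T ih => rw [Finset.sum_range_succ]; linarith [hcp T, hsc T]
  have hsx : Filter.Tendsto (fun t => s ⬝ᵥ x t) Filter.atTop (nhds 0) :=
    (summable_of_sum_range_le (c := p ⬝ᵥ x 0) hs0 fun T =>
      (hbound T).trans (sub_le_self _ (dotProduct_nonneg_of_nonneg hp (hx T)))).tendsto_atTop_zero
  have hxj : ∀ j, Filter.Tendsto (fun t => x t j) Filter.atTop (nhds 0) := by
    intro j
    refine squeeze_zero (fun t => hx t j) (g := fun t => (s j)⁻¹ * (s ⬝ᵥ x t)) (fun t => ?_)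
      (by simpa using hsx.const_mul (s j)⁻¹)
    rw [inv_mul_eq_div, le_div_iff₀ (hs j), mul_comm]
    exact Finset.single_le_sum (f := fun j => s j * x t j)
      (fun k _ => mul_nonneg (hs k).le (hx t k)) (Finset.mem_univ j)
  have hq := tendsto_finsetSum Finset.univ fun j _ => (hxj j).const_mul (q j)
  simpa [dotProduct] using hq

/-- If in every block the feedback `K` attains the minimum in the Bellman operator at the fixed point
`p`, then `p` decreases along the closed loop exactly by the stage cost. -/
lemma dotProduct_eq_stageCost_add {n : ℕ} {m : Fin n → ℕ}
    {A : Matrix (Fin n) (Fin n) ℝ} {B : ∀ i, Matrix (Fin n) (Fin (m i)) ℝ}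
    {s : Fin n → ℝ} {r : ∀ i, Fin (m i) → ℝ} {E : Matrix (Fin n) (Fin n) ℝ}
    {p : Fin n → ℝ} (hfix : p = bellman A B s r E p) {K : ∀ i, Matrix (Fin (m i)) (Fin n) ℝ}
    (hK : ∀ i j, minZero (fun l => r i l + ((B i)ᵀ *ᵥ p) l) * E i j =
      ((r i + (B i)ᵀ *ᵥ p) ᵥ* K i) j) (x : Fin n → ℝ) :
    p ⬝ᵥ x = (s ⬝ᵥ x + ∑ i, r i ⬝ᵥ (K i *ᵥ x)) + p ⬝ᵥ ((A + ∑ i, B i * K i) *ᵥ x) := by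
  have hp : p = s + p ᵥ* A + ∑ i, (r i + p ᵥ* B i) ᵥ* K i := by
    conv_lhs => rw [hfix]
    ext j
    simp only [bellman, hK]
    simp only [mulVec_transpose, Pi.add_apply, Finset.sum_apply]
  conv_lhs => rw [hp]
  simp only [add_dotProduct, sum_dotProduct, add_vecMul, ← dotProduct_mulVec, add_mulVec,
    sum_mulVec, dotProduct_add, dotProduct_sum, ← mulVec_mulVec, Finset.sum_add_distrib]
  ring

/-- A block feedback in `𝒦` maps nonnegative states to admissible inputs. -/
lemma memK.mulVec_mem_inputSet {n : ℕ} {m : Fin n → ℕ} {E : Matrix (Fin n) (Fin n) ℝ}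
    {K : ∀ i, Matrix (Fin (m i)) (Fin n) ℝ} (hK : memK E K) (hE : ∀ i j, 0 ≤ E i j)
    {x : Fin n → ℝ} (hx : 0 ≤ x) : (fun i => K i *ᵥ x) ∈ inputSet E x := by
  refine fun i => ⟨fun l => dotProduct_nonneg_of_nonneg ((hK i).1 l) hx, ?_⟩
  simp only [mulVec, dotProduct]
  rw [Finset.sum_comm]
  refine Finset.sum_le_sum fun j _ => ?_
  rw [← Finset.sum_mul]
  refine mul_le_mul_of_nonneg_right ?_ (hx j)
  rcases (hK i).2 with h | h
  · exact (h j).le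
  · exact (h j).trans_le (hE i j)

/-- under Assumption 1, the blockwise feedback matrix `K` built from a
nonnegative fixed point `p = T(p)` (row `E_iᵀ` at an index `j` attaining the negative
minimum of `r_i + B_iᵀ p`, and `K_i = 0` otherwise) belongs to `𝒦`, and the closed-loop
trajectory `x(t+1) = (A + BK) x(t)`, `u(t) = K x(t)` is admissible with total cost
`pᵀ x0`; i.e. the linear state feedback `u = Kx` is optimal. -/
theorem stmt_5 {n : ℕ} {m : Fin n → ℕ}
    (A : Matrix (Fin n) (Fin n) ℝ) (B : ∀ i, Matrix (Fin n) (Fin (m i)) ℝ)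
    (s : Fin n → ℝ) (r : ∀ i, Fin (m i) → ℝ) (E : Matrix (Fin n) (Fin n) ℝ)
    (hs : ∀ j, 0 < s j) (hr : ∀ i l, 0 ≤ r i l)
    (hE : ∀ i j, 0 ≤ E i j) (hEinv : IsUnit E.det)
    (hA1 : assumption1 A B E)
    (p : Fin n → ℝ) (hp : 0 ≤ p) (hfix : p = bellman A B s r E p)
    (K : ∀ i, Matrix (Fin (m i)) (Fin n) ℝ)
    (hK : ∀ i,
      (minZero (fun l => r i l + ((B i)ᵀ *ᵥ p) l) < 0 →
        ∃ j : Fin (m i),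
          r i j + ((B i)ᵀ *ᵥ p) j = minZero (fun l => r i l + ((B i)ᵀ *ᵥ p) l) ∧
          K i = fun l j' => if l = j then E i j' else 0) ∧
      (0 ≤ minZero (fun l => r i l + ((B i)ᵀ *ᵥ p) l) → K i = 0))
    (x0 : Fin n → ℝ) (hx0 : 0 ≤ x0) :
    memK E K ∧
    admissible A B E x0
      (fun t => ((A + ∑ i, B i * K i) ^ t) *ᵥ x0)
      (fun t i => K i *ᵥ (((A + ∑ i, B i * K i) ^ t) *ᵥ x0)) ∧
    trajCost s r
      (fun t => ((A + ∑ i, B i * K i) ^ t) *ᵥ x0)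
      (fun t i => K i *ᵥ (((A + ∑ i, B i * K i) ^ t) *ᵥ x0)) =
      ENNReal.ofReal (∑ j, p j * x0 j) := by
  have hmem : memK E K := by
    intro i
    rcases lt_or_ge (minZero (fun l => r i l + ((B i)ᵀ *ᵥ p) l)) 0 with h | h
    · obtain ⟨k, -, hKi⟩ := (hK i).1 h
      refine ⟨fun l j => ?_, Or.inl fun j => by simp [hKi]⟩
      rw [hKi]
      dsimp only
      split_ifs
      exacts [hE i j, le_rfl]
    · simp [(hK i).2 h]
  have hmin : ∀ i j, minZero (fun l => r i l + ((B i)ᵀ *ᵥ p) l) * E i j =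
      ((r i + (B i)ᵀ *ᵥ p) ᵥ* K i) j := by
    intro i j
    rcases lt_or_ge (minZero (fun l => r i l + ((B i)ᵀ *ᵥ p) l)) 0 with h | h
    · obtain ⟨k, hk, hKi⟩ := (hK i).1 h
      rw [← hk, hKi]
      simp [vecMul, dotProduct]
    · rw [le_antisymm (minZero_nonpos _) h, (hK i).2 h]
      simp
  set M := A + ∑ i, B i * K i with hM
  have hstep : ∀ t, (M ^ (t + 1)) *ᵥ x0 = M *ᵥ ((M ^ t) *ᵥ x0) := fun t => by
    rw [pow_succ', mulVec_mulVec]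
  have hx : ∀ t, 0 ≤ (M ^ t) *ᵥ x0 := by
    intro t
    induction t with
    | zero => simpa using hx0
    | succ t ih => rw [hstep]; exact hA1 K hmem _ ih
  have hu := fun t => hmem.mulVec_mem_inputSet hE (hx t)
  have hadm : ∀ t, (M ^ (t + 1)) *ᵥ x0 =
      A *ᵥ ((M ^ t) *ᵥ x0) + ∑ i, B i *ᵥ (K i *ᵥ ((M ^ t) *ᵥ x0)) := by
    intro t
    rw [hstep]
    simp only [mulVec_mulVec _ (B _), ← sum_mulVec, ← add_mulVec, hM]
  have htel : ∀ t, p ⬝ᵥ ((M ^ t) *ᵥ x0) =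
      (s ⬝ᵥ ((M ^ t) *ᵥ x0) + ∑ i, r i ⬝ᵥ (K i *ᵥ ((M ^ t) *ᵥ x0))) +
        p ⬝ᵥ ((M ^ (t + 1)) *ᵥ x0) := fun t => by
    rw [hstep]
    exact dotProduct_eq_stageCost_add hfix hmin _
  have hinput : ∀ t, 0 ≤ ∑ i, r i ⬝ᵥ (K i *ᵥ ((M ^ t) *ᵥ x0)) := fun t =>
    Finset.sum_nonneg fun i _ => dotProduct_nonneg_of_nonneg (hr i) (hu t i).1
  refine ⟨hmem, ⟨by simp, fun t => ⟨hu t, hadm t⟩⟩, ?_⟩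
  have hcost := tsum_ofReal_eq_of_telescoping
    (fun t => add_nonneg (dotProduct_nonneg_of_nonneg (fun j => (hs j).le) (hx t)) (hinput t)) htel
    (tendsto_dotProduct_zero_of_telescoping hs hp hx
      (fun t => le_add_of_nonneg_right (hinput t)) htel p)
  rw [pow_zero, one_mulVec] at hcost
  exact hcost
end

section
/- Under Assumption 1, suppose p* ∈ ℝ^n maximizes 1^T p over the feasible set F = {p ∈ ℝ^n : p ≥ 0 and p ≤ T(p)} (i.e., p* ∈ F and 1^T q ≤ 1^T p* for all q ∈ F). Then p* satisfies the fixed-point equation p* = T(p*). -/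
open Matrix Finset

/-- Some vertex `w` of the sub-simplex attains `minZero v`. -/
lemma exists_weight_minZero_eq {k : ℕ} (v : Fin k → ℝ) :
    ∃ w : Fin k → ℝ, (w = 0 ∨ ∃ l, w = Pi.single l 1) ∧ minZero v = ∑ l, w l * v l := by
  have h := Finset.min'_mem (insert (0 : ℝ) (Finset.image v Finset.univ))
    (Finset.insert_nonempty _ _)
  rw [Finset.mem_insert, Finset.mem_image] at h
  rcases h with h | ⟨l, -, h⟩
  · exact ⟨0, Or.inl rfl, by simpa [minZero] using h⟩
  · exact ⟨Pi.single l 1, Or.inr ⟨l, rfl⟩, by simpa [minZero, Pi.single_apply] using h.symm⟩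

/-- Every vertex of the sub-simplex bounds `minZero v` from above. -/
lemma minZero_le_weight {k : ℕ} (v w : Fin k → ℝ) (hw : w = 0 ∨ ∃ l, w = Pi.single l 1) :
    minZero v ≤ ∑ l, w l * v l := by
  rcases hw with rfl | ⟨l, rfl⟩
  · simpa [minZero] using Finset.min'_le _ (0 : ℝ) (Finset.mem_insert_self _ _)
  · simpa [minZero, Pi.single_apply] using Finset.min'_le
      (insert (0 : ℝ) (Finset.image v Finset.univ)) (v l)
      (Finset.mem_insert_of_mem (Finset.mem_image_of_mem v (Finset.mem_univ l)))

/-- Under Assumption 1 the closed-loop matrices are entrywise nonnegative. -/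
lemma assumption1.entry_nonneg {n : ℕ} {m : Fin n → ℕ}
    {A : Matrix (Fin n) (Fin n) ℝ} {B : ∀ i, Matrix (Fin n) (Fin (m i)) ℝ}
    {E : Matrix (Fin n) (Fin n) ℝ} (hA1 : assumption1 A B E)
    {K : ∀ i, Matrix (Fin (m i)) (Fin n) ℝ} (hK : memK E K) (k j : Fin n) :
    0 ≤ A k j + ∑ i, ∑ l, B i k l * K i l j := by
  have h := hA1 K hK (Pi.single j 1) (by simp) k
  simpa [Matrix.sum_apply, Matrix.mul_apply] using h

/-- Under Assumption 1 the Bellman operator is monotone. -/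
lemma bellman_mono {n : ℕ} {m : Fin n → ℕ}
    {A : Matrix (Fin n) (Fin n) ℝ} {B : ∀ i, Matrix (Fin n) (Fin (m i)) ℝ}
    (s : Fin n → ℝ) (r : ∀ i, Fin (m i) → ℝ) {E : Matrix (Fin n) (Fin n) ℝ}
    (hE : ∀ i j, 0 ≤ E i j) (hA1 : assumption1 A B E) :
    Monotone (bellman A B s r E) := by
  intro p q hpq j
  choose w hw hwq using fun i => exists_weight_minZero_eq (fun l => r i l + ((B i)ᵀ *ᵥ q) l)
  have hK : memK E (fun i => Matrix.of fun l j => w i l * E i j) := by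
    intro i
    rcases hw i with h | ⟨l₀, h⟩
    · simp [h]
    · refine ⟨fun l j => ?_, Or.inl fun j => ?_⟩
      · simp only [Matrix.of_apply, h, Pi.single_apply]
        split_ifs <;> simp [hE]
      · simp [h, Pi.single_apply]
  have hdiff : 0 ≤ ∑ k, (A k j + ∑ i, ∑ l, B i k l * (w i l * E i j)) * (q k - p k) :=
    Finset.sum_nonneg fun k _ =>
      mul_nonneg (hA1.entry_nonneg hK k j) (sub_nonneg.2 (hpq k))
  have hexpand : ∑ k, (A k j + ∑ i, ∑ l, B i k l * (w i l * E i j)) * (q k - p k)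
      = ((Aᵀ *ᵥ q) j - (Aᵀ *ᵥ p) j) +
        ((∑ i, (∑ l, w i l * (r i l + ((B i)ᵀ *ᵥ q) l)) * E i j) -
          ∑ i, (∑ l, w i l * (r i l + ((B i)ᵀ *ᵥ p) l)) * E i j) := by
    simp only [Matrix.mulVec, dotProduct, Matrix.transpose_apply, add_mul,
      Finset.sum_add_distrib, ← Finset.sum_sub_distrib, ← sub_mul, ← mul_sub,
      add_sub_add_left_eq_sub]
    congr 1
    simp only [Finset.sum_mul, Finset.mul_sum]
    rw [Finset.sum_comm]
    refine Finset.sum_congr rfl fun i _ => ?_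
    rw [Finset.sum_comm]
    exact Finset.sum_congr rfl fun l _ => Finset.sum_congr rfl fun k _ => by ring
  have hp : ∑ i, minZero (fun l => r i l + ((B i)ᵀ *ᵥ p) l) * E i j
      ≤ ∑ i, (∑ l, w i l * (r i l + ((B i)ᵀ *ᵥ p) l)) * E i j :=
    Finset.sum_le_sum fun i _ =>
      mul_le_mul_of_nonneg_right (minZero_le_weight _ _ (hw i)) (hE i j)
  simp only [bellman, hwq]
  linarith

/-- under Assumption 1, a maximizer `p*` of `1ᵀ p` over the feasible set
`F = {p : p ≥ 0, p ≤ T(p)}` satisfies the fixed-point equation `p* = T(p*)`. -/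
theorem stmt_8 {n : ℕ} {m : Fin n → ℕ}
    (A : Matrix (Fin n) (Fin n) ℝ) (B : ∀ i, Matrix (Fin n) (Fin (m i)) ℝ)
    (s : Fin n → ℝ) (r : ∀ i, Fin (m i) → ℝ) (E : Matrix (Fin n) (Fin n) ℝ)
    (hs : ∀ j, 0 < s j) (hr : ∀ i l, 0 ≤ r i l)
    (hE : ∀ i j, 0 ≤ E i j) (hEinv : IsUnit E.det)
    (hA1 : assumption1 A B E)
    (pstar : Fin n → ℝ) (hpos : 0 ≤ pstar)
    (hfeas : pstar ≤ bellman A B s r E pstar)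
    (hmax : ∀ q : Fin n → ℝ, 0 ≤ q → q ≤ bellman A B s r E q →
      (∑ j, q j) ≤ ∑ j, pstar j) :
    pstar = bellman A B s r E pstar := by
  have hle : ∑ j, bellman A B s r E pstar j ≤ ∑ j, pstar j :=
    hmax _ (hpos.trans hfeas) (bellman_mono s r hE hA1 hfeas)
  have heq := (Finset.sum_eq_sum_iff_of_le fun j _ => hfeas j).1
    (le_antisymm (Finset.sum_le_sum fun j _ => hfeas j) hle)
  exact funext fun j => heq j (Finset.mem_univ j)
end

section
/- Under Assumption 1, if p ∈ ℝ^n with p ≥ 0 satisfies p = T(p), then every h ∈ ℝ^n with h ≥ 0 satisfying the reversed Bellman inequality h ≥ T(h) (i.e., h ≥ s + A^T h + Σ_{i=1}^n min{r_i + B_i^T h, 0} E_i) satisfies h ≥ p entrywise. -/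
open Matrix Finset

/-- The minimum of the entries of `v` and `0` is attained by weights which are either zero or
a vertex of the simplex; such weights bound `minZero` from above at every other vector. -/
lemma exists_weights_eq_minZero {k : ℕ} (v : Fin k → ℝ) :
    ∃ c : Fin k → ℝ, (∀ l, 0 ≤ c l) ∧ (∑ l, c l = 1 ∨ ∀ l, c l = 0) ∧
      ∑ l, c l * v l = minZero v ∧ ∀ w : Fin k → ℝ, minZero w ≤ ∑ l, c l * w l := by
  have hmem : minZero v ∈ insert (0 : ℝ) (Finset.image v Finset.univ) := Finset.min'_mem _ _
  rcases Finset.mem_insert.mp hmem with h0 | h0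
  · exact ⟨0, by simp, Or.inr (by simp), by simp [h0], by simpa using minZero_nonpos⟩
  · obtain ⟨l, -, hl⟩ := Finset.mem_image.mp h0
    refine ⟨Pi.single l 1, fun l' => ?_, Or.inl (by simp), ?_, fun w => ?_⟩
    · by_cases hll : l' = l
      · subst hll; simp
      · simp [hll]
    · simp [Pi.single_apply, hl]
    · simpa [Pi.single_apply] using minZero_le w l

/-- If `d ≤ Mᵀ d` for an entrywise nonnegative `M`, and a positive `h` strictly dominates
`Mᵀ h`, then `d ≤ 0`. -/
lemma nonpos_of_le_transpose_mulVec {ι : Type*} [Fintype ι] (M : Matrix ι ι ℝ)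
    (hM : ∀ i j, 0 ≤ M i j) {h d : ι → ℝ} (hpos : ∀ j, 0 < h j)
    (hlt : ∀ j, (Mᵀ *ᵥ h) j < h j) (hd : d ≤ Mᵀ *ᵥ d) : d ≤ 0 := by
  intro j
  obtain ⟨k, -, hk⟩ := Finset.exists_max_image Finset.univ (fun j => d j / h j)
    ⟨j, Finset.mem_univ j⟩
  by_contra! hj
  have hj' : 0 < d j := hj
  set c := d k / h k with hc
  have hcpos : 0 < c := (div_pos hj' (hpos j)).trans_le (hk j (Finset.mem_univ j))
  have hdc : ∀ i, d i ≤ c * h i := fun i =>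
    (div_le_iff₀ (hpos i)).mp (hk i (Finset.mem_univ i))
  have hdk : d k = c * h k := by rw [hc, div_mul_cancel₀ _ (hpos k).ne']
  have hle : (Mᵀ *ᵥ d) k ≤ c * (Mᵀ *ᵥ h) k := by
    simp only [Matrix.mulVec, dotProduct, Matrix.transpose_apply, Finset.mul_sum]
    refine Finset.sum_le_sum fun i _ => ?_
    calc M i k * d i ≤ M i k * (c * h i) := mul_le_mul_of_nonneg_left (hdc i) (hM i k)
      _ = c * (M i k * h i) := by ring
  have := hd k
  have := mul_lt_mul_of_pos_left (hlt k) hcpos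
  linarith

lemma transpose_closedLoop_mulVec {n : ℕ} {m : Fin n → ℕ}
    (A : Matrix (Fin n) (Fin n) ℝ) (B : ∀ i, Matrix (Fin n) (Fin (m i)) ℝ)
    (K : ∀ i, Matrix (Fin (m i)) (Fin n) ℝ) (q : Fin n → ℝ) (j : Fin n) :
    ((A + ∑ i, B i * K i)ᵀ *ᵥ q) j =
      (Aᵀ *ᵥ q) j + ∑ i, ∑ l, K i l j * ((B i)ᵀ *ᵥ q) l := by
  rw [Matrix.transpose_add, Matrix.transpose_sum, Matrix.add_mulVec, Matrix.sum_mulVec,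
    Pi.add_apply, Finset.sum_apply]
  congr 1
  refine Finset.sum_congr rfl fun i _ => ?_
  rw [Matrix.transpose_mul, ← Matrix.mulVec_mulVec]
  rfl

/-- under Assumption 1, every `h ≥ 0` satisfying the reversed Bellman
inequality `h ≥ T(h)` dominates the nonnegative fixed point `p = T(p)`. -/
theorem stmt_18 {n : ℕ} {m : Fin n → ℕ}
    (A : Matrix (Fin n) (Fin n) ℝ) (B : ∀ i, Matrix (Fin n) (Fin (m i)) ℝ)
    (s : Fin n → ℝ) (r : ∀ i, Fin (m i) → ℝ) (E : Matrix (Fin n) (Fin n) ℝ)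
    (hs : ∀ j, 0 < s j) (hr : ∀ i l, 0 ≤ r i l)
    (hE : ∀ i j, 0 ≤ E i j) (hEinv : IsUnit E.det)
    (hA1 : assumption1 A B E)
    (p : Fin n → ℝ) (hp : 0 ≤ p) (hfix : p = bellman A B s r E p)
    (h : Fin n → ℝ) (hh : 0 ≤ h) (hBell : bellman A B s r E h ≤ h) :
    p ≤ h := by
  choose c hc0 hc1 hceq hcle using fun i =>
    exists_weights_eq_minZero (fun l => r i l + ((B i)ᵀ *ᵥ h) l)
  let K : ∀ i, Matrix (Fin (m i)) (Fin n) ℝ := fun i => Matrix.of fun l j => c i l * E i j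
  have hK : memK E K := by
    refine fun i => ⟨fun l j => mul_nonneg (hc0 i l) (hE i j), ?_⟩
    rcases hc1 i with h1 | h1
    · exact Or.inl fun j => by simp [K, ← Finset.sum_mul, h1]
    · exact Or.inr fun j => by simp [K, h1]
  set M := A + ∑ i, B i * K i with hMdef
  have hM : ∀ i j, 0 ≤ M i j := fun i j => by
    have := hA1 K hK (Pi.single j 1) (Pi.single_nonneg.mpr zero_le_one) i
    simpa [← hMdef] using this
  let R : Fin n → ℝ := fun j => ∑ i, (∑ l, c i l * r i l) * E i j
  have hR : ∀ j, 0 ≤ R j := fun j => Finset.sum_nonneg fun i _ =>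
    mul_nonneg (Finset.sum_nonneg fun l _ => mul_nonneg (hc0 i l) (hr i l)) (hE i j)
  have hclosed : ∀ (q : Fin n → ℝ) j, s j + (Aᵀ *ᵥ q) j +
      ∑ i, (∑ l, c i l * (r i l + ((B i)ᵀ *ᵥ q) l)) * E i j =
        s j + R j + (Mᵀ *ᵥ q) j := fun q j => by
    have hsum : ∑ i, (∑ l, c i l * (r i l + ((B i)ᵀ *ᵥ q) l)) * E i j =
        R j + ∑ i, ∑ l, K i l j * ((B i)ᵀ *ᵥ q) l := by
      simp only [R, K, Matrix.of_apply, ← Finset.sum_add_distrib, Finset.sum_mul]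
      exact Finset.sum_congr rfl fun i _ => Finset.sum_congr rfl fun l _ => by ring
    rw [hsum, hMdef, transpose_closedLoop_mulVec]
    ring
  have hhM : ∀ j, s j + R j + (Mᵀ *ᵥ h) j ≤ h j := fun j => by
    rw [← hclosed h j]
    simpa only [bellman, hceq] using hBell j
  have hpM : ∀ j, p j ≤ s j + R j + (Mᵀ *ᵥ p) j := fun j => by
    rw [← hclosed p j]
    refine (congrFun hfix j).le.trans ?_
    exact add_le_add_right (Finset.sum_le_sum fun i _ =>
      mul_le_mul_of_nonneg_right (hcle i _) (hE i j)) _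
  have hMh : ∀ j, 0 ≤ (Mᵀ *ᵥ h) j := fun j => by
    simp only [Matrix.mulVec, dotProduct, Matrix.transpose_apply]
    exact Finset.sum_nonneg fun i _ => mul_nonneg (hM i j) (hh i)
  refine sub_nonpos.mp (nonpos_of_le_transpose_mulVec M hM (h := h)
    (fun j => ?_) (fun j => ?_) fun j => ?_)
  · linarith [hhM j, hs j, hR j, hMh j]
  · linarith [hhM j, hs j, hR j]
  · rw [Matrix.mulVec_sub, Pi.sub_apply, Pi.sub_apply]
    linarith [hhM j, hpM j]
end
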